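/- Let n = n₁ + n₂ − 1, let x ∈ ℂⁿ be such that L = ℋ(x) has rank r, is μ-incoherent, has singular values σ₁ ≥ ⋯ ≥ σ_r > 0 and condition number κ = σ₁/σ_r, and let s ∈ ℂⁿ be α-sparse with α ≤ c/(μ c_s r κ)² for a sufficiently small absolute constant c > 0. Set z = x + s, τ = 4αμ c_s r κ, υ = 3τ(2√(μ c_s r)κ + μ c_s r κ), β = μ c_s r/(2κn), and suppose τ < 1/12, υ < 1 − τ, and max{4τ + √(1/12), 4υ/((1 − 12τ)(1 − τ − υ)²)} ≤ γ < 1. Fix k ≥ 0, let L_k be rank-r and 4μκ²-incoherent with tangent space T_k, and let x_k satisfy ‖L − L_k‖₂ ≤ 2τγ^kσ_r and ‖x − x_k‖_∞ ≤ ((τ − 2τ²)/(8ακn))γ^kσ_r. Define ζ_{k+1} = βγ^kσ₁(L_k), s_{k+1} = T_{ζ_{k+1}}(z − x_k), L_{k+1} = D_r(P_{T_k}ℋ(z − s_{k+1})), and x_{k+1} = ℋ†(L_{k+1}). Then ‖x − x_{k+1}‖_∞ ≤ ((τ − 2τ²)/(8ακn))γ^{k+1}σ_r. -/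

import Mathlib

open Matrix
open scoped BigOperators

noncomputable section

namespace ASAP

/-- The Hankel operator `ℋ : ℂⁿ → ℂ^{n₁×n₂}`, `[ℋ(x)]_{i,j} = x_{i+j}`. -/
def hankel {n₁ n₂ n : ℕ} (hn : n + 1 = n₁ + n₂) (x : Fin n → ℂ) :
    Matrix (Fin n₁) (Fin n₂) ℂ :=
  Matrix.of fun i j => x ⟨i.1 + j.1, by have hi := i.2; have hj := j.2; omega⟩

open Classical in
/-- The left inverse `ℋ†` of the Hankel operator: averages over antidiagonals. -/
def hankelDagger {n₁ n₂ n : ℕ} (_hn : n + 1 = n₁ + n₂)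
    (M : Matrix (Fin n₁) (Fin n₂) ℂ) : Fin n → ℂ := fun t =>
  (((Finset.univ.filter fun p : Fin n₁ × Fin n₂ => p.1.1 + p.2.1 = t.1).card : ℂ))⁻¹ *
    ∑ p ∈ Finset.univ.filter fun p : Fin n₁ × Fin n₂ => p.1.1 + p.2.1 = t.1, M p.1 p.2

/-- Spectral norm (largest singular value) of a matrix. -/
def specNorm {m n : Type*} [Fintype m] [Fintype n] [DecidableEq n]
    (M : Matrix m n ℂ) : ℝ :=
  ‖LinearMap.toContinuousLinearMap (Matrix.toEuclideanLin M)‖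

/-- Frobenius norm of a matrix. -/
def frobNorm {m n : Type*} [Fintype m] [Fintype n] (M : Matrix m n ℂ) : ℝ :=
  Real.sqrt (∑ i, ∑ j, ‖M i j‖ ^ 2)

/-- `‖·‖_{2,∞}`: maximum ℓ₂ norm of the rows of a matrix. -/
def rowNorm {m n : Type*} [Fintype m] [Fintype n] (M : Matrix m n ℂ) : ℝ :=
  ⨆ i, Real.sqrt (∑ j, ‖M i j‖ ^ 2)

/-- Entrywise max norm of a matrix. -/
def maxNorm {m n : Type*} [Fintype m] [Fintype n] (M : Matrix m n ℂ) : ℝ :=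
  ⨆ i, ⨆ j, ‖M i j‖

/-- ℓ∞ norm of a vector. -/
def vecMaxNorm {n : Type*} [Fintype n] (v : n → ℂ) : ℝ :=
  ⨆ t, ‖v t‖

/-- ℓ₂ norm of a vector. -/
def vecTwoNorm {n : Type*} [Fintype n] (v : n → ℂ) : ℝ :=
  Real.sqrt (∑ t, ‖v t‖ ^ 2)

/-- The augmented Hermitian matrix `[[0, M], [Mᴴ, 0]]`. -/
def aug {m n : Type*} (M : Matrix m n ℂ) : Matrix (m ⊕ n) (m ⊕ n) ℂ :=
  Matrix.fromBlocks 0 M Mᴴ 0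

open Classical in
/-- Support (set of indices of nonzero entries) of a vector. -/
def supp {n : Type*} [Fintype n] (v : n → ℂ) : Finset n :=
  Finset.univ.filter fun t => v t ≠ 0

/-- `α`-sparsity: at most `α·n` nonzero entries. -/
def IsSparse {n : ℕ} (α : ℝ) (s : Fin n → ℂ) : Prop :=
  ((supp s).card : ℝ) ≤ α * n

/-- The hard thresholding operator `T_ζ`. -/
def hardThreshold {n : ℕ} (ζ : ℝ) (v : Fin n → ℂ) : Fin n → ℂ := fun t =>
  if ζ < ‖v t‖ then v t else 0

/-- `c_s = max {n/n₁, n/n₂}`. -/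
def csConst (n₁ n₂ n : ℕ) : ℝ :=
  max ((n : ℝ) / n₁) ((n : ℝ) / n₂)

/-- `(U, σ, V)` is a (compact, rank-`r`, positive and ordered) singular value
decomposition of `L`, i.e. `L = U Σ V*` with orthonormal columns. -/
def IsSVD {m n : Type*} [Fintype m] [Fintype n] {r : ℕ}
    (L : Matrix m n ℂ) (U : Matrix m (Fin r) ℂ) (σ : Fin r → ℝ)
    (V : Matrix n (Fin r) ℂ) : Prop :=
  Uᴴ * U = 1 ∧ Vᴴ * V = 1 ∧ (∀ i, 0 < σ i) ∧ (∀ i j : Fin r, i ≤ j → σ j ≤ σ i) ∧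
    L = U * Matrix.diagonal (fun i => (σ i : ℂ)) * Vᴴ

/-- `μ`-incoherence of a rank-`r` matrix (with respect to `c_s` and `n`). -/
def IsIncoherent {m n' : Type*} [Fintype m] [Fintype n'] (r n : ℕ) (μ cs : ℝ)
    (L : Matrix m n' ℂ) : Prop :=
  ∃ (U : Matrix m (Fin r) ℂ) (σ : Fin r → ℝ) (V : Matrix n' (Fin r) ℂ),
    IsSVD L U σ V ∧ rowNorm U ≤ Real.sqrt (μ * cs * r / n) ∧
      rowNorm V ≤ Real.sqrt (μ * cs * r / n)

/-- Orthogonal projection onto the tangent space determined by `U` and `V`: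
`P_T M = UU*M + MVV* − UU*MVV*`. -/
def tangentProj {m n : Type*} [Fintype m] [Fintype n] {r : ℕ}
    (U : Matrix m (Fin r) ℂ) (V : Matrix n (Fin r) ℂ)
    (M : Matrix m n ℂ) : Matrix m n ℂ :=
  U * Uᴴ * M + M * (V * Vᴴ) - U * Uᴴ * M * (V * Vᴴ)

/-- `L` is a best rank-`r` approximation of `A` with respect to the norm `nrm`. -/
def IsBestApproxWrt {m n : Type*} [Fintype m] [Fintype n] (r : ℕ)
    (nrm : Matrix m n ℂ → ℝ) (A L : Matrix m n ℂ) : Prop :=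
  L.rank ≤ r ∧ ∀ B : Matrix m n ℂ, B.rank ≤ r → nrm (A - L) ≤ nrm (A - B)

/-- Best rank-`r` approximation in Frobenius norm (truncated SVD, `D_r`). -/
def IsBestRankApprox {m n : Type*} [Fintype m] [Fintype n] (r : ℕ)
    (A L : Matrix m n ℂ) : Prop :=
  IsBestApproxWrt r frobNorm A L

/-- Horizontal concatenation of two matrices. -/
def hcat {m a b : Type*} (A : Matrix m a ℂ) (B : Matrix m b ℂ) :
    Matrix m (a ⊕ b) ℂ :=
  Matrix.of fun i => Sum.elim (A i) (B i)


section Aux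

open scoped Matrix.Norms.L2Operator

lemma specNorm_eq {m n : Type*} [Fintype m] [Fintype n] [DecidableEq n]
    (M : Matrix m n ℂ) : specNorm M = ‖M‖ := rfl

lemma opNorm_le {m n : Type*} [Fintype m] [Fintype n] [DecidableEq n]
    (A : Matrix m n ℂ) (C : ℝ) (hC : 0 ≤ C)
    (h : ∀ x : n → ℂ, ∑ i, ‖(A *ᵥ x) i‖ ^ 2 ≤ C ^ 2 * ∑ j, ‖x j‖ ^ 2) : ‖A‖ ≤ C := by
  rw [Matrix.l2_opNorm_def]
  refine ContinuousLinearMap.opNorm_le_bound _ hC fun x => ?_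
  refine (sq_le_sq₀ (by positivity) (by positivity)).mp ?_
  rw [mul_pow, EuclideanSpace.norm_sq_eq, EuclideanSpace.norm_sq_eq]
  exact h x.ofLp

lemma opNorm_le_frob {m n : Type*} [Fintype m] [Fintype n] [DecidableEq n]
    (A : Matrix m n ℂ) : ‖A‖ ≤ frobNorm A := by
  refine opNorm_le A _ (Real.sqrt_nonneg _) fun x => ?_
  rw [frobNorm, Real.sq_sqrt (by positivity), Finset.sum_mul]
  refine Finset.sum_le_sum fun i _ => ?_
  have h1 : ‖(A *ᵥ x) i‖ ≤ ∑ j, ‖A i j‖ * ‖x j‖ := by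
    refine (norm_sum_le _ _).trans (le_of_eq ?_)
    simp
  refine (pow_le_pow_left₀ (norm_nonneg _) h1 2).trans ?_
  exact Finset.sum_mul_sq_le_sq_mul_sq _ _ _

lemma schur_test {m n : Type*} [Fintype m] [Fintype n] [DecidableEq n]
    (A : Matrix m n ℂ) (C : ℝ) (hC : 0 ≤ C) (hr : ∀ i, ∑ j, ‖A i j‖ ≤ C)
    (hc : ∀ j, ∑ i, ‖A i j‖ ≤ C) : ‖A‖ ≤ C := by
  refine opNorm_le A _ hC fun x => ?_
  have h1 : ∀ i, ‖(A *ᵥ x) i‖ ^ 2 ≤ C * ∑ j, ‖A i j‖ * ‖x j‖ ^ 2 := by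
    intro i
    have h1 : ‖(A *ᵥ x) i‖ ≤ ∑ j, ‖A i j‖ * ‖x j‖ := by
      refine (norm_sum_le _ _).trans (le_of_eq ?_)
      simp
    have h2 : (∑ j, ‖A i j‖ * ‖x j‖) ^ 2 ≤ (∑ j, ‖A i j‖) * ∑ j, ‖A i j‖ * ‖x j‖ ^ 2 := by
      refine Finset.sum_sq_le_sum_mul_sum_of_sq_le_mul _ (fun _ _ => by positivity)
        (fun _ _ => by positivity) (fun j _ => le_of_eq (by ring))
    refine (pow_le_pow_left₀ (norm_nonneg _) h1 2).trans (h2.trans ?_)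
    exact mul_le_mul_of_nonneg_right (hr i) (by positivity)
  refine (Finset.sum_le_sum fun i _ => h1 i).trans ?_
  rw [← Finset.mul_sum, Finset.sum_comm, pow_two, mul_assoc]
  refine mul_le_mul_of_nonneg_left ?_ hC
  rw [Finset.mul_sum]
  refine Finset.sum_le_sum fun j _ => ?_
  rw [← Finset.sum_mul]
  exact mul_le_mul_of_nonneg_right (hc j) (by positivity)

lemma norm_one_one (X : Matrix (Fin 1) (Fin 1) ℂ) : ‖X‖ = ‖X 0 0‖ := by
  have : X = Matrix.diagonal (fun i => X i i) := by
    ext i j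
    fin_cases i; fin_cases j; simp
  rw [this, Matrix.l2_opNorm_diagonal]
  simp [Pi.norm_def]

/-- row selector -/
def rsel {m : Type*} [DecidableEq m] (i : m) : Matrix (Fin 1) m ℂ :=
  Matrix.of fun _ k => if k = i then 1 else 0

lemma rsel_mul {m n : Type*} [Fintype m] [DecidableEq m] (i : m) (A : Matrix m n ℂ) (k : Fin 1)
    (j : n) : (rsel i * A) k j = A i j := by
  simp [rsel, Matrix.mul_apply]

lemma mul_rselH {m n : Type*} [Fintype m] [DecidableEq m] (i : m) (A : Matrix n m ℂ) (k : Fin 1)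
    (j : n) : (A * (rsel i)ᴴ) j k = A j i := by
  simp [rsel, Matrix.mul_apply, Matrix.conjTranspose_apply]

lemma norm_row_sq {n : Type*} [Fintype n] [DecidableEq n] (a : Matrix (Fin 1) n ℂ) :
    ‖a‖ ^ 2 = ∑ j, ‖a 0 j‖ ^ 2 := by
  have h := Matrix.l2_opNorm_conjTranspose_mul_self aᴴ
  rw [Matrix.l2_opNorm_conjTranspose, Matrix.conjTranspose_conjTranspose, norm_one_one] at h
  rw [pow_two, ← h, Matrix.mul_apply]
  simp only [Matrix.conjTranspose_apply, RCLike.star_def, Complex.mul_conj]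
  rw [← Complex.ofReal_sum, Complex.norm_real, Real.norm_of_nonneg]
  · simp [Complex.normSq_eq_norm_sq]
  · exact Finset.sum_nonneg fun _ _ => Complex.normSq_nonneg _

lemma norm_rsel_mul_sq {m n : Type*} [Fintype m] [DecidableEq m] [Fintype n] [DecidableEq n]
    (i : m) (A : Matrix m n ℂ) : ‖rsel i * A‖ ^ 2 = ∑ j, ‖A i j‖ ^ 2 := by
  rw [norm_row_sq]; simp [rsel_mul]

lemma norm_rsel_le_rowNorm {m n : Type*} [Fintype m] [DecidableEq m] [Fintype n] [DecidableEq n]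
    (i : m) (A : Matrix m n ℂ) : ‖rsel i * A‖ ≤ rowNorm A := by
  have : ‖rsel i * A‖ = Real.sqrt (∑ j, ‖A i j‖ ^ 2) := by
    rw [← norm_rsel_mul_sq, Real.sqrt_sq (norm_nonneg _)]
  rw [this]
  exact le_ciSup (f := fun i => Real.sqrt (∑ j, ‖A i j‖ ^ 2)) (Set.finite_range _).bddAbove i

lemma frob_sq {m n : Type*} [Fintype m] [Fintype n] (A : Matrix m n ℂ) :
    frobNorm A ^ 2 = ∑ i, ∑ j, ‖A i j‖ ^ 2 := Real.sq_sqrt (by positivity)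

lemma frob_sq_trace {m n : Type*} [Fintype m] [Fintype n] (A : Matrix m n ℂ) :
    frobNorm A ^ 2 = (Matrix.trace (Aᴴ * A)).re := by
  rw [frob_sq, Finset.sum_comm, Matrix.trace, Complex.re_sum]
  refine Finset.sum_congr rfl fun j _ => ?_
  simp only [Matrix.diag_apply, Matrix.mul_apply, Matrix.conjTranspose_apply, Complex.re_sum]
  refine Finset.sum_congr rfl fun i _ => ?_
  rw [RCLike.star_def, mul_comm, Complex.mul_conj, Complex.ofReal_re, Complex.normSq_eq_norm_sq]

lemma frob_nonneg {m n : Type*} [Fintype m] [Fintype n] (A : Matrix m n ℂ) :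
    0 ≤ frobNorm A := Real.sqrt_nonneg _

lemma frob_H {m n : Type*} [Fintype m] [Fintype n] (A : Matrix m n ℂ) :
    frobNorm Aᴴ = frobNorm A := by
  simp only [frobNorm, Matrix.conjTranspose_apply, norm_star]
  rw [Finset.sum_comm]

lemma frob_zero {m n : Type*} [Fintype m] [Fintype n] (A : Matrix m n ℂ)
    (h : frobNorm A ^ 2 = 0) : A = 0 := by
  rw [frob_sq] at h
  ext i j
  rw [Finset.sum_eq_zero_iff_of_nonneg (fun _ _ => by positivity)] at h
  have h2 := h i (Finset.mem_univ _)
  rw [Finset.sum_eq_zero_iff_of_nonneg (fun _ _ => by positivity)] at h2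
  have h3 := h2 j (Finset.mem_univ _)
  simpa using h3

/-- first order optimality -/
lemma best_left {m n : Type*} [Fintype m] [Fintype n] (r : ℕ)
    (A L : Matrix m n ℂ) (h : IsBestRankApprox r A L) : Lᴴ * (A - L) = 0 := by
  classical
  obtain ⟨hr, hb⟩ := h
  set R := A - L with hR
  apply frob_zero
  set p := frobNorm (Lᴴ * R) ^ 2 with hp
  set q := frobNorm (L * (Lᴴ * R)) ^ 2 with hq
  have hp0 : 0 ≤ p := sq_nonneg _
  have hq0 : 0 ≤ q := sq_nonneg _
  have key : ∀ t : ℝ, 0 ≤ -(2 * t) * p + t ^ 2 * q := by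
    intro t
    have hB := hb (L * (1 + (t : ℂ) • (Lᴴ * R))) ((Matrix.rank_mul_le_left _ _).trans hr)
    have e : A - L * (1 + (t : ℂ) • (Lᴴ * R)) = R - (t : ℂ) • (L * (Lᴴ * R)) := by
      rw [Matrix.mul_add, Matrix.mul_one, Matrix.mul_smul, hR]; abel
    rw [e] at hB
    have h2 := pow_le_pow_left₀ (frob_nonneg _) hB 2
    have e2 : frobNorm (R - (t : ℂ) • (L * (Lᴴ * R))) ^ 2
        = frobNorm R ^ 2 - 2 * t * p + t ^ 2 * q := by
      rw [hp, hq]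
      simp only [frob_sq_trace]
      have e3 : (R - (t : ℂ) • (L * (Lᴴ * R)))ᴴ * (R - (t : ℂ) • (L * (Lᴴ * R)))
          = Rᴴ * R - (t : ℂ) • ((Lᴴ * R)ᴴ * (Lᴴ * R)) - (t : ℂ) • ((Lᴴ * R)ᴴ * (Lᴴ * R))
            + ((t : ℂ) * t) • ((L * (Lᴴ * R))ᴴ * (L * (Lᴴ * R))) := by
        simp only [Matrix.conjTranspose_sub, Matrix.conjTranspose_smul, Matrix.conjTranspose_mul,
          Matrix.conjTranspose_conjTranspose, Matrix.sub_mul, Matrix.mul_sub, Matrix.smul_mul,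
          Matrix.mul_smul,
          RCLike.star_def, Complex.conj_ofReal, Matrix.mul_assoc, smul_sub, smul_smul]
        abel
      rw [e3]
      simp only [Matrix.trace_add, Matrix.trace_sub, Matrix.trace_smul, smul_eq_mul,
        Complex.add_re, Complex.sub_re, Complex.re_ofReal_mul, mul_assoc]
      ring
    rw [e2] at h2
    linarith
  by_contra hne
  have hpp : 0 < p := lt_of_le_of_ne hp0 (Ne.symm hne)
  have := key (p / (q + 1))
  have h3 : -(2 * (p / (q + 1))) * p + (p / (q + 1)) ^ 2 * q
      = -(p ^ 2 / (q + 1) ^ 2) * (q + 2) := by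
    field_simp; ring
  rw [h3] at this
  have : 0 < (p ^ 2 / (q + 1) ^ 2) * (q + 2) := by positivity
  linarith

open scoped ComplexOrder in
lemma rank_H {m n : Type*} [Fintype m] [Fintype n] (A : Matrix m n ℂ) : Aᴴ.rank = A.rank :=
  Matrix.rank_conjTranspose A

lemma best_H {m n : Type*} [Fintype m] [Fintype n] (r : ℕ)
    (A L : Matrix m n ℂ) (h : IsBestRankApprox r A L) : IsBestRankApprox r Aᴴ Lᴴ := by
  refine ⟨by rw [rank_H]; exact h.1, fun B hB => ?_⟩
  have := h.2 Bᴴ (by rw [rank_H]; exact hB)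
  rw [← Matrix.conjTranspose_sub, frob_H, ← frob_H, Matrix.conjTranspose_sub]
  rw [← frob_H (A - L), ← frob_H (A - Bᴴ), Matrix.conjTranspose_sub, Matrix.conjTranspose_sub,
    Matrix.conjTranspose_conjTranspose] at this
  exact this

lemma norm_le_one_of_orth {m : Type*} [Fintype m] [DecidableEq m] {r : ℕ}
    (U : Matrix m (Fin r) ℂ) (h : Uᴴ * U = 1) : ‖U‖ ≤ 1 := by
  have h1 := Matrix.l2_opNorm_conjTranspose_mul_self U
  have h2 : ‖(1 : Matrix (Fin r) (Fin r) ℂ)‖ ≤ 1 := by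
    rw [← Matrix.diagonal_one, Matrix.l2_opNorm_diagonal]
    exact (pi_norm_le_iff_of_nonneg zero_le_one).2 (by simp)
  rw [h] at h1
  nlinarith [norm_nonneg U]

lemma norm_compl_le_one {m : Type*} [Fintype m] [DecidableEq m] {r : ℕ}
    (U : Matrix m (Fin r) ℂ) (h : Uᴴ * U = 1) : ‖1 - U * Uᴴ‖ ≤ 1 := by
  have h1 := Matrix.l2_opNorm_conjTranspose_mul_self (1 - U * Uᴴ)
  have h2 : (1 - U * Uᴴ)ᴴ * (1 - U * Uᴴ) = 1 - U * Uᴴ := by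
    have : U * Uᴴ * (U * Uᴴ) = U * Uᴴ := by
      rw [Matrix.mul_assoc, ← Matrix.mul_assoc Uᴴ, h, Matrix.one_mul]
    simp only [Matrix.conjTranspose_sub, Matrix.conjTranspose_one, Matrix.conjTranspose_mul,
          Matrix.conjTranspose_conjTranspose, sub_mul, mul_sub, one_mul, mul_one, this]
    abel
  rw [h2] at h1
  nlinarith [norm_nonneg (1 - U * Uᴴ)]

lemma mul_le {l m n : Type*} [Fintype l] [Fintype m] [Fintype n] [DecidableEq m] [DecidableEq n]
    (A : Matrix l m ℂ) (B : Matrix m n ℂ) {p q : ℝ} (hA : ‖A‖ ≤ p) (hB : ‖B‖ ≤ q) :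
    ‖A * B‖ ≤ p * q :=
  (Matrix.l2_opNorm_mul A B).trans
    (mul_le_mul hA hB (norm_nonneg _) ((norm_nonneg _).trans hA))

/-- existence of the factorization through a full-rank compression -/
lemma factor {m n : Type*} [Fintype m] [Fintype n] [DecidableEq m] [DecidableEq n] {r : ℕ}
    (A : Matrix m n ℂ) (U : Matrix m (Fin r) ℂ) (V : Matrix n (Fin r) ℂ) (hr : A.rank ≤ r)
    (hK : IsUnit (Uᴴ * A * V)) : ∃ X : Matrix (Fin r) n ℂ, A = A * V * X := by
  have h1 : (Uᴴ * A * V).rank = r := by rw [Matrix.rank_of_isUnit _ hK]; simp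
  have h2 : r ≤ (A * V).rank := by
    refine h1.ge.trans ?_
    rw [Matrix.mul_assoc]; exact Matrix.rank_mul_le_right _ _
  have hle : LinearMap.range (A * V).mulVecLin ≤ LinearMap.range A.mulVecLin := by
    rw [Matrix.mulVecLin_mul]; exact LinearMap.range_comp_le_range _ _
  have heq : LinearMap.range (A * V).mulVecLin = LinearMap.range A.mulVecLin :=
    Submodule.eq_of_le_of_finrank_le hle (hr.trans h2)
  have h3 : ∀ j : n, ∃ y : Fin r → ℂ, (A * V) *ᵥ y = A *ᵥ (Pi.single j 1) := by
    intro j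
    have : A *ᵥ (Pi.single j 1) ∈ LinearMap.range (A * V).mulVecLin := by
      rw [heq]; exact ⟨_, rfl⟩
    exact this
  choose y hy using h3
  refine ⟨Matrix.of fun i j => y j i, ?_⟩
  ext i j
  have := congrFun (hy j) i
  rw [Matrix.mulVec_single_one] at this
  rw [Matrix.mul_apply]
  exact this.symm

/-- columns of the residual -/
lemma resid {m n : Type*} [Fintype m] [Fintype n] [DecidableEq m] [DecidableEq n] {r : ℕ}
    (L Lh H R : Matrix m n ℂ) (V : Matrix n (Fin r) ℂ) (b : Matrix n (Fin 1) ℂ)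
    (hV : Vᴴ * V = 1) (hL : L * V * Vᴴ = L) (hW : L + H = Lh + R) (hR : Lhᴴ * R = 0)
    {d g h : ℝ} (hd : ‖Lh - L‖ ≤ d) (hg : ‖Vᴴ * b‖ ≤ g) (hh : ‖H * b‖ ≤ h) :
    ‖(Lh - L) * b‖ ≤ 2 * h + d * g := by
  have hRL : Rᴴ * Lh = 0 := by
    have := congrArg Matrix.conjTranspose hR
    simpa [Matrix.conjTranspose_mul] using this
  have hd' : ‖L - Lh‖ ≤ d := by rwa [norm_sub_rev]
  have hVn := norm_le_one_of_orth V hV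
  have e1 : (R * b)ᴴ * (R * b) = (R * b)ᴴ * ((L - Lh) * (V * (Vᴴ * b)) + H * b) := by
    have e2 : (R * b)ᴴ * (Lh * (V * (Vᴴ * b))) = 0 := by
      rw [Matrix.conjTranspose_mul, Matrix.mul_assoc, ← Matrix.mul_assoc Rᴴ, hRL]; simp
    have e3 : (R * b)ᴴ * (Lh * b) = 0 := by
      rw [Matrix.conjTranspose_mul, Matrix.mul_assoc, ← Matrix.mul_assoc Rᴴ, hRL]; simp
    have e4 : L * (V * (Vᴴ * b)) = L * b := by
      rw [← Matrix.mul_assoc, ← Matrix.mul_assoc, hL]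
    have e5 : R = L + H - Lh := by rw [hW]; abel
    rw [Matrix.sub_mul, Matrix.mul_add, Matrix.mul_sub, e2, e4]
    conv_lhs => enter [2]; rw [e5, Matrix.sub_mul, Matrix.add_mul]
    rw [Matrix.mul_sub, e3, Matrix.mul_add]
    abel
  have hRb : ‖R * b‖ ≤ d * g + h := by
    have h1 := Matrix.l2_opNorm_conjTranspose_mul_self (R * b)
    have h2 : ‖(L - Lh) * (V * (Vᴴ * b)) + H * b‖ ≤ d * (1 * g) + h :=
      (norm_add_le _ _).trans (add_le_add (mul_le _ _ hd' (mul_le _ _ hVn hg)) hh)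
    have h3 := Matrix.l2_opNorm_mul (R * b)ᴴ ((L - Lh) * (V * (Vᴴ * b)) + H * b)
    rw [← e1, h1, Matrix.l2_opNorm_conjTranspose] at h3
    by_contra hcon
    push Not at hcon
    have h0 : 0 ≤ d * g + h := by
      have := norm_nonneg ((L - Lh) * (V * (Vᴴ * b)) + H * b); linarith
    have : 0 < ‖R * b‖ := by linarith
    have := le_of_mul_le_mul_left h3 this
    linarith
  have e : (Lh - L) * b = H * b - R * b := by
    rw [← Matrix.sub_mul]; congr 1
    rw [sub_eq_sub_iff_add_eq_add, ← hW]; abel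
  rw [e]
  have := norm_sub_le (H * b) (R * b)
  linarith

lemma entry_bound {m n : Type*} [Fintype m] [Fintype n] [DecidableEq m] [DecidableEq n] {r : ℕ}
    (L Lh H R : Matrix m n ℂ) (U : Matrix m (Fin r) ℂ) (σ : Fin r → ℝ) (V : Matrix n (Fin r) ℂ)
    (hS : IsSVD L U σ V) (a : Matrix (Fin 1) m ℂ) (b : Matrix n (Fin 1) ℂ)
    (hW : L + H = Lh + R) (hR : Lhᴴ * R = 0) (hR' : Lh * Rᴴ = 0) (hrk : Lh.rank ≤ r)
    {d g h σr : ℝ} (hd : ‖Lh - L‖ ≤ d) (hga : ‖a * U‖ ≤ g) (hg : ‖Vᴴ * b‖ ≤ g)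
    (hha : ‖a * H‖ ≤ h) (hh : ‖H * b‖ ≤ h) (hσ0 : 0 < σr) (hσ : ∀ i, σr ≤ σ i) (hdσ : d < σr) :
    ‖a * (Lh - L) * b‖ ≤ 2 * g * (2 * h + d * g) + g * d * g +
      (2 * h + 2 * d * g) * ((2 * h + 2 * d * g) / (σr - d)) := by
  obtain ⟨hU, hV, hpos, -, hL⟩ := hS
  set S : Matrix (Fin r) (Fin r) ℂ := Matrix.diagonal (fun i => (σ i : ℂ)) with hSd
  have hUn := norm_le_one_of_orth U hU
  have hVn := norm_le_one_of_orth V hV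
  have hUHn : ‖Uᴴ‖ ≤ 1 := by rwa [Matrix.l2_opNorm_conjTranspose]
  have hVHn : ‖Vᴴ‖ ≤ 1 := by rwa [Matrix.l2_opNorm_conjTranspose]
  set D := Lh - L with hD
  have hLV : L * V * Vᴴ = L := by
    rw [hL]; simp only [Matrix.mul_assoc]; rw [← Matrix.mul_assoc Vᴴ V, hV, Matrix.one_mul]
  have hLU : U * Uᴴ * L = L := by
    rw [hL]; simp only [Matrix.mul_assoc]; rw [← Matrix.mul_assoc Uᴴ U, hU, Matrix.one_mul]
  have hDb : ‖D * b‖ ≤ 2 * h + d * g := resid L Lh H R V b hV hLV hW hR hd hg hh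
  have haD : ‖a * D‖ ≤ 2 * h + d * g := by
    have := resid Lᴴ Lhᴴ Hᴴ Rᴴ U aᴴ hU
      (by have := congrArg Matrix.conjTranspose hLU
          simpa [Matrix.conjTranspose_mul, Matrix.mul_assoc] using this)
      (by rw [← Matrix.conjTranspose_add, hW, Matrix.conjTranspose_add])
      (by simpa using hR') (d := d) (g := g) (h := h)
      (by rwa [← Matrix.conjTranspose_sub, Matrix.l2_opNorm_conjTranspose])
      (by rwa [← Matrix.conjTranspose_mul, Matrix.l2_opNorm_conjTranspose])
      (by rwa [← Matrix.conjTranspose_mul, Matrix.l2_opNorm_conjTranspose])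
    rwa [← Matrix.conjTranspose_sub, ← Matrix.conjTranspose_mul,
      Matrix.l2_opNorm_conjTranspose] at this
  -- invertibility of the compression
  set Si : Matrix (Fin r) (Fin r) ℂ := Matrix.diagonal (fun i => ((σ i : ℂ))⁻¹) with hSi
  have hSiS : Si * S = 1 := by
    rw [hSi, hSd, Matrix.diagonal_mul_diagonal, ← Matrix.diagonal_one]
    congr 1; ext i
    exact inv_mul_cancel₀ (by exact_mod_cast (hpos i).ne')
  have hSSi : S * Si = 1 := mul_eq_one_comm.1 hSiS
  have hSin : ‖Si‖ ≤ 1 / σr := by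
    rw [hSi, Matrix.l2_opNorm_diagonal]
    refine (pi_norm_le_iff_of_nonneg (by positivity)).2 fun i => ?_
    rw [norm_inv, Complex.norm_real, Real.norm_of_nonneg (hpos i).le, one_div]
    exact inv_anti₀ hσ0 (hσ i)
  have hULV : Uᴴ * L * V = S := by
    rw [hL]; simp only [Matrix.mul_assoc]; rw [hV, ← Matrix.mul_assoc Uᴴ U, hU]; simp
  have hKeq : Uᴴ * Lh * V = S + Uᴴ * D * V := by
    rw [← hULV, hD]; simp only [Matrix.mul_sub, Matrix.sub_mul]; abel
  have hUDV : ‖Uᴴ * D * V‖ ≤ d := by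
    have := mul_le _ _ (mul_le _ _ hUHn hd) hVn
    simpa using this
  have hd0 : 0 ≤ d := (norm_nonneg _).trans hd
  have hK : IsUnit (Uᴴ * Lh * V) := by
    have h1 : Uᴴ * Lh * V = S * (1 - (-(Si * (Uᴴ * D * V)))) := by
      rw [hKeq, sub_neg_eq_add, mul_add, mul_one, ← mul_assoc, hSSi, one_mul]
    have h2 : ‖-(Si * (Uᴴ * D * V))‖ < 1 := by
      rw [norm_neg]
      refine (mul_le _ _ hSin hUDV).trans_lt ?_
      rw [one_div, inv_mul_lt_iff₀ hσ0]; linarith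
    rw [h1]
    exact (IsUnit.of_mul_eq_one _ hSSi).mul (isUnit_one_sub_of_norm_lt_one h2)
  obtain ⟨X, hX⟩ := factor Lh U V hrk hK
  set Y : Matrix (Fin r) (Fin 1) ℂ := X * ((1 - V * Vᴴ) * b) with hY
  have hLQ : L * ((1 - V * Vᴴ) * b) = 0 := by
    rw [← Matrix.mul_assoc, Matrix.mul_sub, Matrix.mul_one, ← Matrix.mul_assoc, hLV]; simp
  have hDQ : D * ((1 - V * Vᴴ) * b) = Lh * ((1 - V * Vᴴ) * b) := by
    rw [hD, Matrix.sub_mul, hLQ, sub_zero]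
  have hYeq : S * Y = Uᴴ * (D * ((1 - V * Vᴴ) * b)) - (Uᴴ * D * V) * Y := by
    rw [eq_sub_iff_add_eq, ← Matrix.add_mul, ← hKeq, hDQ]
    conv_rhs => rw [hX]
    simp only [hY, Matrix.mul_assoc]
  have hDQn : ‖D * ((1 - V * Vᴴ) * b)‖ ≤ 2 * h + 2 * d * g := by
    have e : D * ((1 - V * Vᴴ) * b) = D * b - D * (V * (Vᴴ * b)) := by
      rw [Matrix.sub_mul 1, Matrix.one_mul, Matrix.mul_sub, Matrix.mul_assoc]
    rw [e]
    have := norm_sub_le (D * b) (D * (V * (Vᴴ * b)))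
    have := mul_le _ _ hd (mul_le _ _ hVn hg)
    linarith
  have hYn : ‖Y‖ ≤ (2 * h + 2 * d * g) / (σr - d) := by
    have e : Y = Si * (S * Y) := by rw [← Matrix.mul_assoc, hSiS, Matrix.one_mul]
    have h1 : ‖S * Y‖ ≤ 1 * (2 * h + 2 * d * g) + d * ‖Y‖ := by
      rw [hYeq]
      exact (norm_sub_le _ _).trans (add_le_add (mul_le _ _ hUHn hDQn) (mul_le _ _ hUDV le_rfl))
    have h2 := mul_le _ _ hSin h1
    rw [← e, one_div, ← div_eq_inv_mul, le_div_iff₀ hσ0] at h2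
    rw [le_div_iff₀ (by linarith)]
    linarith
  have e : a * D * b = a * U * (Uᴴ * (D * b)) + a * D * (V * (Vᴴ * b))
      - a * U * (Uᴴ * D * (V * (Vᴴ * b)))
      + (a * D * V - a * U * (Uᴴ * D * V)) * Y := by
    have e1 : (a * D * V - a * U * (Uᴴ * D * V)) * Y
        = a * ((1 - U * Uᴴ) * (Lh * ((1 - V * Vᴴ) * b))) := by
      have e2 : (1 - U * Uᴴ) * D = (1 - U * Uᴴ) * Lh := by
        rw [hD, Matrix.mul_sub, Matrix.sub_mul 1 _ L, hLU, Matrix.one_mul, sub_self, sub_zero]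
      have e3 : (a * D * V - a * U * (Uᴴ * D * V)) = a * ((1 - U * Uᴴ) * D * V) := by
        simp only [Matrix.sub_mul, Matrix.mul_sub, Matrix.one_mul, Matrix.mul_assoc]
      rw [e3, e2]
      conv_rhs => rw [hX]
      simp only [hY, Matrix.mul_assoc]
    rw [e1, ← hDQ]
    simp only [Matrix.sub_mul, Matrix.mul_sub, Matrix.one_mul, Matrix.mul_assoc]
    abel
  rw [e]
  have t1 : ‖a * U * (Uᴴ * (D * b))‖ ≤ g * (1 * (2 * h + d * g)) :=
    mul_le _ _ hga (mul_le _ _ hUHn hDb)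
  have t2 : ‖a * D * (V * (Vᴴ * b))‖ ≤ (2 * h + d * g) * (1 * g) :=
    mul_le _ _ haD (mul_le _ _ hVn hg)
  have t3 : ‖a * U * (Uᴴ * D * (V * (Vᴴ * b)))‖ ≤ g * (1 * d * (1 * g)) :=
    mul_le _ _ hga (mul_le _ _ (mul_le _ _ hUHn hd) (mul_le _ _ hVn hg))
  have t4 : ‖(a * D * V - a * U * (Uᴴ * D * V)) * Y‖ ≤
      ((2 * h + d * g) * 1 + g * d) * ((2 * h + 2 * d * g) / (σr - d)) :=
    mul_le _ _ ((norm_sub_le _ _).trans (add_le_add (mul_le _ _ haD hVn) (mul_le _ _ hga hUDV))) hYn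
  have n1 := norm_add_le (a * U * (Uᴴ * (D * b)) + a * D * (V * (Vᴴ * b))
      - a * U * (Uᴴ * D * (V * (Vᴴ * b)))) ((a * D * V - a * U * (Uᴴ * D * V)) * Y)
  have n2 := norm_sub_le (a * U * (Uᴴ * (D * b)) + a * D * (V * (Vᴴ * b)))
      (a * U * (Uᴴ * D * (V * (Vᴴ * b))))
  have n3 := norm_add_le (a * U * (Uᴴ * (D * b))) (a * D * (V * (Vᴴ * b)))
  have e4 : ((2 * h + d * g) * 1 + g * d) = 2 * h + 2 * d * g := by ring
  rw [e4] at t4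
  linarith

lemma H_row {m n : Type*} [Fintype m] [Fintype n] [DecidableEq m] [DecidableEq n] {r : ℕ}
    (L Lk E : Matrix m n ℂ) (U : Matrix m (Fin r) ℂ) (σ : Fin r → ℝ) (V : Matrix n (Fin r) ℂ)
    (hS : IsSVD L U σ V)
    (Uk : Matrix m (Fin r) ℂ) (σk : Fin r → ℝ) (Vk : Matrix n (Fin r) ℂ)
    (hSk : IsSVD Lk Uk σk Vk) (a : Matrix (Fin 1) m ℂ)
    {g gk e1 e2 e3 : ℝ} (hg : ‖a * U‖ ≤ g) (hgk : ‖a * Uk‖ ≤ gk)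
    (he1 : ‖L - Lk‖ ≤ e1) (he2 : ‖E‖ ≤ e2) (he3 : ‖a * (E * Vk)‖ ≤ e3) :
    ‖a * (tangentProj Uk Vk (L + E) - L)‖ ≤ (g + gk) * e1 + 2 * gk * e2 + e3 := by
  obtain ⟨hU, hV, -, -, hL⟩ := hS
  obtain ⟨hUk, hVk, -, -, hLk⟩ := hSk
  have hUn := norm_le_one_of_orth U hU
  have hUkn := norm_le_one_of_orth Uk hUk
  have hVkn := norm_le_one_of_orth Vk hVk
  have hUHn : ‖Uᴴ‖ ≤ 1 := by rwa [Matrix.l2_opNorm_conjTranspose]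
  have hUkHn : ‖Ukᴴ‖ ≤ 1 := by rwa [Matrix.l2_opNorm_conjTranspose]
  have hVkHn : ‖Vkᴴ‖ ≤ 1 := by rwa [Matrix.l2_opNorm_conjTranspose]
  have hQ := norm_compl_le_one Vk hVk
  have hLU : U * Uᴴ * L = L := by
    rw [hL]; simp only [Matrix.mul_assoc]; rw [← Matrix.mul_assoc Uᴴ U, hU, Matrix.one_mul]
  have hLkV : Lk * (1 - Vk * Vkᴴ) = 0 := by
    rw [Matrix.mul_sub, Matrix.mul_one, hLk]; simp only [Matrix.mul_assoc]
    rw [← Matrix.mul_assoc Vkᴴ Vk, hVk, Matrix.one_mul, sub_self]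
  have eL : L * (1 - Vk * Vkᴴ) = U * (Uᴴ * ((L - Lk) * (1 - Vk * Vkᴴ))) := by
    rw [Matrix.sub_mul, hLkV, sub_zero, ← Matrix.mul_assoc, ← Matrix.mul_assoc, hLU]
  have e : a * (tangentProj Uk Vk (L + E) - L) =
      -((a * U - a * Uk * (Ukᴴ * U)) * (Uᴴ * ((L - Lk) * (1 - Vk * Vkᴴ))))
      + a * Uk * (Ukᴴ * E) + a * (E * Vk) * Vkᴴ - a * Uk * (Ukᴴ * E * (Vk * Vkᴴ)) := by
    have e5 : (a * U - a * Uk * (Ukᴴ * U)) * (Uᴴ * ((L - Lk) * (1 - Vk * Vkᴴ)))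
        = a * ((1 - Uk * Ukᴴ) * (L * (1 - Vk * Vkᴴ))) := by
      rw [eL]
      simp only [Matrix.sub_mul, Matrix.mul_sub, Matrix.one_mul, Matrix.mul_assoc]
    rw [e5, tangentProj]
    simp only [Matrix.sub_mul, Matrix.mul_sub, Matrix.one_mul, Matrix.mul_one, Matrix.mul_assoc,
      Matrix.mul_add, Matrix.add_mul]
    abel
  rw [e]
  have t1 : ‖(a * U - a * Uk * (Ukᴴ * U)) * (Uᴴ * ((L - Lk) * (1 - Vk * Vkᴴ)))‖ ≤
      (g + gk * (1 * 1)) * (1 * (e1 * 1)) :=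
    mul_le _ _ ((norm_sub_le _ _).trans (add_le_add hg (mul_le _ _ hgk (mul_le _ _ hUkHn hUn))))
      (mul_le _ _ hUHn (mul_le _ _ he1 hQ))
  have t2 : ‖a * Uk * (Ukᴴ * E)‖ ≤ gk * (1 * e2) := mul_le _ _ hgk (mul_le _ _ hUkHn he2)
  have t3 : ‖a * (E * Vk) * Vkᴴ‖ ≤ e3 * 1 := mul_le _ _ he3 hVkHn
  have t4 : ‖a * Uk * (Ukᴴ * E * (Vk * Vkᴴ))‖ ≤ gk * (1 * e2 * (1 * 1)) :=
    mul_le _ _ hgk (mul_le _ _ (mul_le _ _ hUkHn he2) (mul_le _ _ hVkn hVkHn))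
  have n1 := norm_sub_le (-((a * U - a * Uk * (Ukᴴ * U)) * (Uᴴ * ((L - Lk) * (1 - Vk * Vkᴴ))))
      + a * Uk * (Ukᴴ * E) + a * (E * Vk) * Vkᴴ) (a * Uk * (Ukᴴ * E * (Vk * Vkᴴ)))
  have n2 := norm_add_le (-((a * U - a * Uk * (Ukᴴ * U)) * (Uᴴ * ((L - Lk) * (1 - Vk * Vkᴴ))))
      + a * Uk * (Ukᴴ * E)) (a * (E * Vk) * Vkᴴ)
  have n3 := norm_add_le (-((a * U - a * Uk * (Ukᴴ * U)) * (Uᴴ * ((L - Lk) * (1 - Vk * Vkᴴ)))))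
      (a * Uk * (Ukᴴ * E))
  rw [norm_neg] at n3
  linarith

lemma IsSVD.H {m n : Type*} [Fintype m] [Fintype n] {r : ℕ}
    {L : Matrix m n ℂ} {U : Matrix m (Fin r) ℂ} {σ : Fin r → ℝ} {V : Matrix n (Fin r) ℂ}
    (h : IsSVD L U σ V) : IsSVD Lᴴ V σ U := by
  obtain ⟨h1, h2, h3, h4, h5⟩ := h
  refine ⟨h2, h1, h3, h4, ?_⟩
  rw [h5]
  simp only [Matrix.conjTranspose_mul, Matrix.conjTranspose_conjTranspose,
    Matrix.diagonal_conjTranspose, Matrix.mul_assoc]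
  congr 3
  ext i; simp

lemma tangentProj_H {m n : Type*} [Fintype m] [Fintype n] {r : ℕ}
    (U : Matrix m (Fin r) ℂ) (V : Matrix n (Fin r) ℂ) (M : Matrix m n ℂ) :
    (tangentProj U V M)ᴴ = tangentProj V U Mᴴ := by
  simp only [tangentProj, Matrix.conjTranspose_sub, Matrix.conjTranspose_add,
    Matrix.conjTranspose_mul, Matrix.conjTranspose_conjTranspose, Matrix.mul_assoc]
  abel

lemma rsel_E {m n : Type*} [Fintype m] [Fintype n] [DecidableEq m] [DecidableEq n] {r : ℕ}
    (E : Matrix m n ℂ) (V : Matrix n (Fin r) ℂ) (i : m) {g C : ℝ} (hg0 : 0 ≤ g)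
    (hg : ∀ j : n, ‖rsel j * V‖ ≤ g) (hC : ∑ j, ‖E i j‖ ≤ C) :
    ‖rsel i * (E * V)‖ ≤ C * g := by
  have e : rsel i * (E * V) = ∑ j, E i j • (rsel j * V) := by
    ext k l
    rw [rsel_mul, Matrix.sum_apply, Matrix.mul_apply]
    simp [rsel_mul]
  rw [e]
  calc _ ≤ ∑ j, ‖E i j‖ * g := by
        refine (norm_sum_le _ _).trans (Finset.sum_le_sum fun j _ => ?_)
        exact (norm_smul_le _ _).trans (mul_le_mul_of_nonneg_left (hg j) (norm_nonneg _))
    _ ≤ C * g := by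
        rw [← Finset.sum_mul]; exact mul_le_mul_of_nonneg_right hC hg0

lemma frob_le_rows {m n : Type*} [Fintype m] [Fintype n] [DecidableEq m] [DecidableEq n]
    (A : Matrix m n ℂ) {h : ℝ} (hh : ∀ i : m, ‖rsel i * A‖ ≤ h) :
    frobNorm A ^ 2 ≤ Fintype.card m * h ^ 2 := by
  rw [frob_sq]
  refine (Finset.sum_le_card_nsmul _ _ (h ^ 2) fun i _ => ?_).trans (le_of_eq (by simp))
  rw [← norm_rsel_mul_sq]
  exact pow_le_pow_left₀ (norm_nonneg _) (hh i) 2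

lemma frob_orth {m : Type*} [Fintype m] {r : ℕ} (U : Matrix m (Fin r) ℂ) (h : Uᴴ * U = 1) :
    frobNorm U ^ 2 = r := by
  rw [frob_sq_trace, h]; simp

lemma norm_svd {m n : Type*} [Fintype m] [Fintype n] [DecidableEq m] [DecidableEq n] {r : ℕ}
    {L : Matrix m n ℂ} {U : Matrix m (Fin r) ℂ} {σ : Fin r → ℝ} {V : Matrix n (Fin r) ℂ}
    (h : IsSVD L U σ V) (hr : 0 < r) : ‖L‖ = σ ⟨0, hr⟩ := by
  obtain ⟨hU, hV, hpos, hord, hL⟩ := h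
  have hUn := norm_le_one_of_orth U hU
  have hVn := norm_le_one_of_orth V hV
  have hUHn : ‖Uᴴ‖ ≤ 1 := by rwa [Matrix.l2_opNorm_conjTranspose]
  have hVHn : ‖Vᴴ‖ ≤ 1 := by rwa [Matrix.l2_opNorm_conjTranspose]
  have hS : ‖Matrix.diagonal (fun i => (σ i : ℂ))‖ = σ ⟨0, hr⟩ := by
    rw [Matrix.l2_opNorm_diagonal]
    apply le_antisymm
    · refine (pi_norm_le_iff_of_nonneg (hpos _).le).2 fun i => ?_
      rw [Complex.norm_real, Real.norm_of_nonneg (hpos i).le]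
      exact hord _ _ (Fin.mk_le_mk.2 (Nat.zero_le _))
    · have := norm_le_pi_norm (fun i => (σ i : ℂ)) ⟨0, hr⟩
      rwa [Complex.norm_real, Real.norm_of_nonneg (hpos _).le] at this
  apply le_antisymm
  · rw [hL]
    have := mul_le _ _ (mul_le _ _ hUn hS.le) hVHn
    simpa using this
  · have hULV : Uᴴ * L * V = Matrix.diagonal (fun i => (σ i : ℂ)) := by
      rw [hL]; simp only [Matrix.mul_assoc]; rw [hV, ← Matrix.mul_assoc Uᴴ U, hU]; simp
    rw [← hS, ← hULV]
    have := mul_le _ _ (mul_le _ _ hUHn (le_refl ‖L‖)) hVn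
    simpa using this

lemma hankel_add {n₁ n₂ n : ℕ} (hn : n + 1 = n₁ + n₂) (x y : Fin n → ℂ) :
    hankel hn (x + y) = hankel hn x + hankel hn y := by
  ext i j; simp [hankel]

lemma sum_inj_le {ι : Type*} [Fintype ι] {n : ℕ} (φ : ι → Fin n) (hφ : Function.Injective φ)
    (e s : Fin n → ℂ) (B : ℝ) (h1 : ∀ t, s t = 0 → e t = 0) (h2 : ∀ t, ‖e t‖ ≤ B) :
    ∑ j, ‖e (φ j)‖ ≤ (supp s).card * B := by
  classical
  calc ∑ j, ‖e (φ j)‖ = ∑ t ∈ Finset.univ.image φ, ‖e t‖ := by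
        rw [Finset.sum_image (fun a _ b _ h => hφ h)]
    _ ≤ ∑ t, ‖e t‖ := Finset.sum_le_univ_sum_of_nonneg (fun _ => norm_nonneg _)
    _ = ∑ t ∈ supp s, ‖e t‖ := by
        symm
        apply Finset.sum_subset (Finset.subset_univ _)
        intro t _ ht
        have : s t = 0 := by simpa [supp] using ht
        rw [h1 t this, norm_zero]
    _ ≤ (supp s).card * B := by
        refine (Finset.sum_le_card_nsmul _ _ B fun t _ => h2 t).trans (le_of_eq (by simp))

lemma hankelDagger_err {n₁ n₂ n : ℕ} (hn : n + 1 = n₁ + n₂) (h1 : 0 < n₁) (h2 : 0 < n₂)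
    (x : Fin n → ℂ) (A : Matrix (Fin n₁) (Fin n₂) ℂ) (C : ℝ)
    (hC : ∀ i j, ‖(A - hankel hn x) i j‖ ≤ C) (t : Fin n) :
    ‖(x - hankelDagger hn A) t‖ ≤ C := by
  classical
  set F := Finset.univ.filter fun p : Fin n₁ × Fin n₂ => p.1.1 + p.2.1 = t.1 with hF
  have hne : F.Nonempty := by
    have ht := t.2
    by_cases h : t.1 < n₁
    · exact ⟨(⟨t.1, h⟩, ⟨0, h2⟩), by simp [hF]⟩
    · refine ⟨(⟨n₁ - 1, by omega⟩, ⟨t.1 - (n₁ - 1), by omega⟩), ?_⟩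
      simp only [hF, Finset.mem_filter, Finset.mem_univ, true_and]; omega
  have hcard : (0 : ℝ) < F.card := by exact_mod_cast hne.card_pos
  have hcc : (F.card : ℂ) ≠ 0 := by exact_mod_cast hne.card_pos.ne'
  have e : (x - hankelDagger hn A) t = (F.card : ℂ)⁻¹ * ∑ p ∈ F, (x t - A p.1 p.2) := by
    rw [Finset.sum_sub_distrib, Finset.sum_const, nsmul_eq_mul, mul_sub, ← mul_assoc,
      inv_mul_cancel₀ hcc, one_mul]
    simp only [Pi.sub_apply, hankelDagger, hF]
  rw [e, norm_mul, norm_inv, Complex.norm_natCast, inv_mul_le_iff₀ hcard]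
  refine (norm_sum_le _ _).trans ((Finset.sum_le_card_nsmul _ _ C fun p hp => ?_).trans
    (le_of_eq (by simp)))
  have hp' : p.1.1 + p.2.1 = t.1 := by simpa [hF] using hp
  have := hC p.1 p.2
  rw [Matrix.sub_apply, norm_sub_rev] at this
  have e2 : hankel hn x p.1 p.2 = x t := by
    simp only [hankel, Matrix.of_apply]; congr 1; exact Fin.ext hp'
  rwa [e2] at this

lemma le_vecMaxNorm {n : ℕ} (v : Fin n → ℂ) (t : Fin n) : ‖v t‖ ≤ vecMaxNorm v :=
  le_ciSup (f := fun t => ‖v t‖) (Set.finite_range _).bddAbove t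

/-- thresholding step -/
lemma threshold {n : ℕ} (x s xk : Fin n → ℂ) (ζ B : ℝ) (hB : ∀ t, ‖(x - xk) t‖ ≤ B)
    (hBζ : B ≤ ζ) (t : Fin n) :
    (s t = 0 → (s - hardThreshold ζ (x + s - xk)) t = 0) ∧
      ‖(s - hardThreshold ζ (x + s - xk)) t‖ ≤ ζ + B := by
  have hb := hB t
  have hb0 := (norm_nonneg _).trans hb
  simp only [Pi.sub_apply, hardThreshold, Pi.add_apply] at *
  constructor
  · intro h
    rw [h, add_zero, if_neg (by linarith), sub_zero]
  · split_ifs with h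
    · have : s t - (x t + s t - xk t) = -(x t - xk t) := by ring
      rw [this, norm_neg]; linarith
    · have : s t - 0 = (x t + s t - xk t) - (x t - xk t) := by ring
      rw [this]
      have := norm_sub_le (x t + s t - xk t) (x t - xk t)
      linarith

lemma numeric (q G δ σr τ γ : ℝ) (hq : 0 ≤ q) (hq' : q ≤ 4 / 10000) (hG : 0 ≤ G)
    (hδ : 0 < δ) (hδσ : δ ≤ σr) (hτ : τ < 1 / 12) (hγ : 28 / 100 ≤ γ) :
    2 * G * (2 * (15 / 2 * q * G * δ) + 15 * q * δ * G) + G * (15 * q * δ) * G +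
      (2 * (15 / 2 * q * G * δ) + 2 * (15 * q * δ) * G) *
        ((2 * (15 / 2 * q * G * δ) + 2 * (15 * q * δ) * G) / (σr - 15 * q * δ))
      ≤ (1 - 2 * τ) / 2 * G ^ 2 * (γ * δ) := by
  have h1 : δ / 2 ≤ σr - 15 * q * δ := by nlinarith
  have h2 : (2 * (15 / 2 * q * G * δ) + 2 * (15 * q * δ) * G) / (σr - 15 * q * δ) ≤
      90 * q * G := by
    rw [div_le_iff₀ (by linarith)]
    have : 0 ≤ 90 * q * G := by positivity
    nlinarith [mul_le_mul_of_nonneg_left h1 this]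
  have h3 : 0 ≤ 2 * (15 / 2 * q * G * δ) + 2 * (15 * q * δ) * G := by positivity
  have h4 := mul_le_mul_of_nonneg_left h2 h3
  have hGd : 0 ≤ G ^ 2 * δ := by positivity
  have h5 : 75 * q + 4050 * q ^ 2 ≤ 1 / 10 := by nlinarith
  have h6 : 1 / 10 ≤ (1 - 2 * τ) / 2 * γ := by nlinarith
  have h7 := mul_le_mul_of_nonneg_right (h5.trans h6) hGd
  nlinarith

end Aux

set_option maxHeartbeats 2000000 in
open scoped Matrix.Norms.L2Operator in
/-- entrywise contraction for the next iterate `x_{k+1}`. -/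
theorem statement15 :
    ∃ c : ℝ, 0 < c ∧
    ∀ (n₁ n₂ n r : ℕ) (hn : n + 1 = n₁ + n₂), 0 < n₁ → 0 < n₂ → (hr : 0 < r) →
    ∀ (μ α κ cs τ υ β : ℝ), 0 < μ → 0 < α →
    ∀ (x s : Fin n → ℂ)
      (U : Matrix (Fin n₁) (Fin r) ℂ) (σ : Fin r → ℝ) (V : Matrix (Fin n₂) (Fin r) ℂ),
      IsSVD (hankel hn x) U σ V →
      cs = csConst n₁ n₂ n →
      rowNorm U ≤ Real.sqrt (μ * cs * r / n) →
      rowNorm V ≤ Real.sqrt (μ * cs * r / n) →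
      κ = σ ⟨0, hr⟩ / σ ⟨r - 1, by omega⟩ →
      IsSparse α s →
      α ≤ c / (μ * cs * r * κ) ^ 2 →
      τ = 4 * α * μ * cs * r * κ →
      υ = 3 * τ * (2 * Real.sqrt (μ * cs * r) * κ + μ * cs * r * κ) →
      β = μ * cs * r / (2 * κ * n) →
      τ < 1 / 12 →
      υ < 1 - τ →
    ∀ γ : ℝ,
      max (4 * τ + Real.sqrt (1 / 12)) (4 * υ / ((1 - 12 * τ) * (1 - τ - υ) ^ 2)) ≤ γ →
      γ < 1 →
    ∀ (k : ℕ) (Lk : Matrix (Fin n₁) (Fin n₂) ℂ) (xk : Fin n → ℂ)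
      (Uk : Matrix (Fin n₁) (Fin r) ℂ) (σk : Fin r → ℝ) (Vk : Matrix (Fin n₂) (Fin r) ℂ),
      IsSVD Lk Uk σk Vk →
      rowNorm Uk ≤ Real.sqrt (4 * μ * κ ^ 2 * cs * r / n) →
      rowNorm Vk ≤ Real.sqrt (4 * μ * κ ^ 2 * cs * r / n) →
      specNorm (hankel hn x - Lk) ≤ 2 * τ * γ ^ k * σ ⟨r - 1, by omega⟩ →
      vecMaxNorm (x - xk) ≤ (τ - 2 * τ ^ 2) / (8 * α * κ * n) * γ ^ k * σ ⟨r - 1, by omega⟩ →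
    ∀ (Lk1 : Matrix (Fin n₁) (Fin n₂) ℂ) (xk1 : Fin n → ℂ),
      IsBestRankApprox r
        (tangentProj Uk Vk (hankel hn
          (x + s - hardThreshold (β * γ ^ k * specNorm Lk) (x + s - xk)))) Lk1 →
      xk1 = hankelDagger hn Lk1 →
      vecMaxNorm (x - xk1)
        ≤ (τ - 2 * τ ^ 2) / (8 * α * κ * n) * γ ^ (k + 1) * σ ⟨r - 1, by omega⟩ := by
  refine ⟨1 / 10000, by norm_num, ?_⟩
  intro n₁ n₂ n r hn hn₁ hn₂ hr μ α κ cs τ υ β hμ hα x s U σ V hS hcs hU hV hκ hs hαc hτ hυ hβ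
    hτ1 hυ1 γ hγ hγ1 k Lk xk Uk σk Vk hSk hUk hVk hLk hxk Lk1 xk1 hbest hxk1
  clear hυ hυ1
  set σr := σ ⟨r - 1, by omega⟩ with hσr
  have hσpos : 0 < σr := hS.2.2.1 _
  have hσmin : ∀ i, σr ≤ σ i := fun i => hS.2.2.2.1 _ _ (Fin.mk_le_mk.2 (by have := i.2; omega))
  have hσ0 : σ ⟨0, hr⟩ = κ * σr := by rw [hκ]; field_simp
  have hκ1 : 1 ≤ κ := by rw [hκ, le_div_iff₀ hσpos, one_mul]; exact hσmin _
  have hκ0 : 0 < κ := by linarith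
  have hnpos : 0 < n := by omega
  have hN : (0 : ℝ) < n := by exact_mod_cast hnpos
  have hN1 : (0 : ℝ) < n₁ := by exact_mod_cast hn₁
  have hn1n : (n₁ : ℝ) ≤ n := by exact_mod_cast (by omega : n₁ ≤ n)
  have hcs0 : 0 < cs := by
    rw [hcs, csConst]; exact lt_max_of_lt_left (by positivity)
  have hr0 : (1 : ℝ) ≤ r := by exact_mod_cast hr
  set M := μ * cs * r with hM
  have hM0 : 0 < M := by positivity
  set g := Real.sqrt (M / n) with hg
  have hg0 : 0 ≤ g := Real.sqrt_nonneg _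
  have hg2 : g ^ 2 = M / n := Real.sq_sqrt (by positivity)
  have hgk : Real.sqrt (4 * μ * κ ^ 2 * cs * r / n) = 2 * κ * g := by
    rw [hg, show 4 * μ * κ ^ 2 * cs * r / n = (2 * κ) ^ 2 * (M / n) by rw [hM]; ring,
      Real.sqrt_mul (by positivity), Real.sqrt_sq (by positivity)]
  rw [hgk] at hUk hVk
  have rU : ∀ i : Fin n₁, ‖rsel i * U‖ ≤ g := fun i => (norm_rsel_le_rowNorm i U).trans hU
  have rV : ∀ i : Fin n₂, ‖rsel i * V‖ ≤ g := fun i => (norm_rsel_le_rowNorm i V).trans hV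
  have rUk : ∀ i : Fin n₁, ‖rsel i * Uk‖ ≤ 2 * κ * g :=
    fun i => (norm_rsel_le_rowNorm i Uk).trans hUk
  have rVk : ∀ i : Fin n₂, ‖rsel i * Vk‖ ≤ 2 * κ * g :=
    fun i => (norm_rsel_le_rowNorm i Vk).trans hVk
  have hM1 : 1 ≤ M := by
    have h1 := frob_le_rows U rU
    rw [frob_orth U hS.1, hg2, Fintype.card_fin, ← mul_div_assoc, le_div_iff₀ hN] at h1
    have h2 : (n₁ : ℝ) * M ≤ n * M := mul_le_mul_of_nonneg_right hn1n hM0.le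
    have h3 : (1 : ℝ) * n ≤ r * n := mul_le_mul_of_nonneg_right hr0 hN.le
    have h4 : 1 * (n : ℝ) ≤ M * n := by linarith
    exact le_of_mul_le_mul_right h4 hN
  have hτM : τ = 4 * (α * M) * κ := by rw [hτ, hM]; ring
  have hτ0 : 0 < τ := by rw [hτM]; positivity
  have hγ0 : 28 / 100 ≤ γ := by
    have h1 := (le_max_left _ _).trans hγ
    have h2 : (28 / 100 : ℝ) ≤ Real.sqrt (1 / 12) := Real.le_sqrt_of_sq_le (by norm_num)
    linarith
  set q := κ * τ * M with hq
  have hq0 : 0 ≤ q := by positivity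
  have hq1 : q ≤ 4 / 10000 := by
    rw [le_div_iff₀ (by positivity)] at hαc
    have : q = 4 * (α * (M * κ) ^ 2) := by rw [hq, hτM]; ring
    rw [this]; linarith
  have hγp : 0 < γ ^ k := pow_pos (by linarith) k
  have hγle : γ ^ k ≤ 1 := pow_le_one₀ (by linarith) hγ1.le
  set δ := γ ^ k * σr with hδ
  have hδ0 : 0 < δ := by positivity
  have hδσ : δ ≤ σr := by rw [hδ]; nlinarith
  have hcoef : (τ - 2 * τ ^ 2) / (8 * α * κ * n) = (1 - 2 * τ) / 2 * (M / n) := by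
    rw [show τ - 2 * τ ^ 2 = τ * (1 - 2 * τ) by ring]
    conv_lhs => rw [show τ * (1 - 2 * τ) = 4 * (α * M) * κ * (1 - 2 * τ) by rw [← hτM]]
    field_simp
    ring
  rw [hcoef] at hxk ⊢
  set L := hankel hn x with hL
  have hLk' : ‖L - Lk‖ ≤ 2 * τ * δ := by
    rw [← specNorm_eq, hδ]; linarith
  have hLn : ‖L‖ = κ * σr := by rw [norm_svd hS hr, hσ0]
  set ζ := β * γ ^ k * specNorm Lk with hζ
  have hβ' : β * κ = (M / n) / 2 := by rw [hβ, hM]; field_simp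
  have hβ0 : 0 < β := by rw [hβ]; positivity
  have hτκ : τ * δ ≤ τ * (κ * σr) :=
    mul_le_mul_of_nonneg_left (hδσ.trans (le_mul_of_one_le_left hσpos.le hκ1)) hτ0.le
  have hLk1 : (1 - 2 * τ) * (κ * σr) ≤ specNorm Lk := by
    rw [specNorm_eq]
    have h1 := norm_sub_norm_le L Lk
    linarith
  have hLk2 : specNorm Lk ≤ (1 + 2 * τ) * (κ * σr) := by
    rw [specNorm_eq]
    have h1 := norm_sub_norm_le Lk L
    rw [norm_sub_rev] at h1
    linarith
  have hβγ : 0 ≤ β * γ ^ k := by positivity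
  have hζ1 : (1 - 2 * τ) / 2 * (M / n) * δ ≤ ζ := by
    have := mul_le_mul_of_nonneg_left hLk1 hβγ
    calc _ = (β * κ) * ((1 - 2 * τ) * δ) := by rw [hβ']; ring
      _ = β * γ ^ k * ((1 - 2 * τ) * (κ * σr)) := by rw [hδ]; ring
      _ ≤ ζ := this
  have hζ2 : ζ ≤ (1 + 2 * τ) / 2 * (M / n) * δ := by
    have := mul_le_mul_of_nonneg_left hLk2 hβγ
    calc ζ ≤ β * γ ^ k * ((1 + 2 * τ) * (κ * σr)) := this
      _ = (β * κ) * ((1 + 2 * τ) * δ) := by rw [hδ]; ring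
      _ = _ := by rw [hβ']; ring
  have hxk' : ∀ t, ‖(x - xk) t‖ ≤ (1 - 2 * τ) / 2 * (M / n) * δ := fun t =>
    (le_vecMaxNorm _ t).trans (hxk.trans (le_of_eq (by rw [hδ]; ring)))
  set e := s - hardThreshold ζ (x + s - xk) with he
  have hth := threshold x s xk ζ _ hxk' hζ1
  have he1 : ∀ t, s t = 0 → e t = 0 := fun t => (hth t).1
  have he2 : ∀ t, ‖e t‖ ≤ M / n * δ := fun t => by
    have := (hth t).2
    linarith
  have hxe : x + s - hardThreshold ζ (x + s - xk) = x + e := by rw [he]; abel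
  rw [hxe, hankel_add, ← hL] at hbest
  set E := hankel hn e with hE
  have hB0 : 0 ≤ M / n * δ := by positivity
  have hcardB : ((supp s).card : ℝ) * (M / n * δ) ≤ α * M * δ := by
    refine (mul_le_mul_of_nonneg_right hs hB0).trans (le_of_eq ?_)
    field_simp
  have hrow : ∀ i, ∑ j, ‖E i j‖ ≤ α * M * δ := fun i =>
    (sum_inj_le (fun j : Fin n₂ => (⟨i.1 + j.1, by have hi := i.2; have hj := j.2; omega⟩ : Fin n))
      (fun a b h => by have := congrArg Fin.val h; exact Fin.ext (by simpa using this))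
      e s _ he1 he2).trans hcardB
  have hcol : ∀ j, ∑ i, ‖E i j‖ ≤ α * M * δ := fun j =>
    (sum_inj_le (fun i : Fin n₁ => (⟨i.1 + j.1, by have hi := i.2; have hj := j.2; omega⟩ : Fin n))
      (fun a b h => by have := congrArg Fin.val h; exact Fin.ext (by simpa using this))
      e s _ he1 he2).trans hcardB
  have hEn : ‖E‖ ≤ α * M * δ := schur_test E _ (by positivity) hrow hcol
  set W := tangentProj Uk Vk (L + E) with hW
  set H := W - L with hH
  have hsum : (g + 2 * κ * g) * (2 * τ * δ) + 2 * (2 * κ * g) * (α * M * δ)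
      + (α * M * δ) * (2 * κ * g) ≤ 15 / 2 * (κ * τ) * (g * δ) := by
    have h0 : 0 ≤ g * δ := by positivity
    have h1 : 2 * τ + 3 / 2 * τ ≤ 7 / 2 * (κ * τ) := by nlinarith
    calc _ = (2 * τ + 4 * (κ * τ) + 3 / 2 * (4 * (α * M) * κ)) * (g * δ) := by ring
      _ = (2 * τ + 4 * (κ * τ) + 3 / 2 * τ) * (g * δ) := by rw [← hτM]
      _ ≤ (15 / 2 * (κ * τ)) * (g * δ) := mul_le_mul_of_nonneg_right (by linarith) h0
  have hκg : 0 ≤ 2 * κ * g := by positivity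
  have hHr : ∀ i : Fin n₁, ‖rsel i * H‖ ≤ 15 / 2 * (κ * τ) * (g * δ) := fun i =>
    (H_row L Lk E U σ V hS Uk σk Vk hSk (rsel i) (rU i) (rUk i) hLk' hEn
      (rsel_E E Vk i hκg rVk (hrow i))).trans hsum
  have hHc : ∀ j : Fin n₂, ‖H * (rsel j)ᴴ‖ ≤ 15 / 2 * (κ * τ) * (g * δ) := fun j => by
    have h1 := (H_row Lᴴ Lkᴴ Eᴴ V σ U hS.H Vk σk Uk hSk.H (rsel j) (rV j) (rVk j)
      (by rw [← Matrix.conjTranspose_sub, Matrix.l2_opNorm_conjTranspose]; exact hLk')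
      (by rw [Matrix.l2_opNorm_conjTranspose]; exact hEn)
      (rsel_E Eᴴ Uk j hκg rUk (by simpa using hcol j))).trans hsum
    rw [← Matrix.conjTranspose_add, ← tangentProj_H, ← Matrix.conjTranspose_sub,
      ← Matrix.l2_opNorm_conjTranspose, Matrix.conjTranspose_mul,
      Matrix.conjTranspose_conjTranspose] at h1
    exact h1
  have hfrob : frobNorm H ≤ 15 / 2 * q * δ := by
    refine (sq_le_sq₀ (frob_nonneg H) (mul_nonneg (mul_nonneg (by norm_num) hq0) hδ0.le)).mp ?_
    refine (frob_le_rows H hHr).trans ?_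
    rw [Fintype.card_fin]
    have h1 : (n₁ : ℝ) * g ^ 2 ≤ M := by
      rw [hg2, ← mul_div_assoc, div_le_iff₀ hN, mul_comm M]
      exact mul_le_mul_of_nonneg_right hn1n hM0.le
    have h2 : (n₁ : ℝ) * g ^ 2 ≤ M ^ 2 := by nlinarith
    calc (n₁ : ℝ) * (15 / 2 * (κ * τ) * (g * δ)) ^ 2
        = (15 / 2 * (κ * τ) * δ) ^ 2 * (n₁ * g ^ 2) := by ring
      _ ≤ (15 / 2 * (κ * τ) * δ) ^ 2 * M ^ 2 := mul_le_mul_of_nonneg_left h2 (sq_nonneg _)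
      _ = _ := by rw [hq]; ring
  have hLrank : L.rank ≤ r := by
    rw [hS.2.2.2.2, Matrix.mul_assoc]
    exact (Matrix.rank_mul_le_left _ _).trans (by simpa using Matrix.rank_le_width U)
  set R := W - Lk1 with hR
  have hRf : frobNorm R ≤ frobNorm H := hbest.2 L hLrank
  have hd : ‖Lk1 - L‖ ≤ 15 * q * δ := by
    have e1 : Lk1 - L = H - R := by rw [hH, hR]; abel
    rw [e1]
    have := norm_sub_le H R
    have := opNorm_le_frob H
    have := opNorm_le_frob R
    linarith
  have hR1 : Lk1ᴴ * R = 0 := best_left r W Lk1 hbest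
  have hR2 : Lk1 * Rᴴ = 0 := by
    have := best_left r Wᴴ Lk1ᴴ (best_H r W Lk1 hbest)
    rwa [Matrix.conjTranspose_conjTranspose, ← Matrix.conjTranspose_sub] at this
  have hh : 15 / 2 * (κ * τ) * (g * δ) ≤ 15 / 2 * q * g * δ := by
    have h1 : κ * τ ≤ q := le_mul_of_one_le_right (by positivity) hM1
    have h0 : 0 ≤ g * δ := by positivity
    nlinarith [mul_le_mul_of_nonneg_right h1 h0]
  have hdσ : 15 * q * δ < σr := by nlinarith
  have hent : ∀ i j, ‖(Lk1 - L) i j‖ ≤ (1 - 2 * τ) / 2 * g ^ 2 * (γ * δ) := fun i j => by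
    have h1 := entry_bound L Lk1 H R U σ V hS (rsel i) (rsel j)ᴴ
      (by rw [hH, hR]; abel) hR1 hR2 hbest.1 hd (rU i)
      (by rw [← Matrix.conjTranspose_mul, Matrix.l2_opNorm_conjTranspose]; exact rV j)
      ((hHr i).trans hh) ((hHc j).trans hh) hσpos hσmin hdσ
    rw [norm_one_one, mul_rselH, rsel_mul] at h1
    exact h1.trans (numeric q g δ σr τ γ hq0 hq1 hg0 hδ0 hδσ hτ1 hγ0)
  have : Nonempty (Fin n) := ⟨⟨0, hnpos⟩⟩
  refine ciSup_le fun t => ?_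
  rw [hxk1]
  refine (hankelDagger_err hn hn₁ hn₂ x Lk1 _ hent t).trans (le_of_eq ?_)
  rw [hg2, hδ]; ring

end ASAP
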